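/- arXiv:2006.15046 — 2 statements merged into one kernel-verified Lean document; each statement's English description precedes it below -/
import Mathlib

section
/- Let α ∈ (0,2) with α ≠ 1, let β, β₁ ∈ (0,1), let λ : ℕ → ℝ be strictly increasing with λ k > 0 for all k and λ k → ∞, and let a : ℕ → ℝ with Summable (fun k => |a k|). If ∑' k, a k * E_{α,1}(-(λ k)^β * t^α) = ∑' k, a k * E_{α,1}(-(λ k)^{β₁} * t^α) for every t > 0, then for every natural number ℓ ≥ 1 such that (ℓ : ℝ) * α is not a positive integer, ∑' k, a k * (λ k)^(-(β*ℓ)) = ∑' k, a k * (λ k)^(-(β₁*ℓ)). -/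
/-- The Mittag-Leffler function `E_{α,1}(z) = ∑_{n=0}^∞ z^n / Γ(α n + 1)`. -/
noncomputable def mittagLeffler (α z : ℝ) : ℝ :=
  ∑' n : ℕ, z ^ n / Real.Gamma (α * n + 1)

open MeasureTheory Set Filter Topology

section MittagLefflerSeries

theorem Real.rpow_mul_exp_neg_le_Gamma {A x : ℝ} (hA : 0 ≤ A) (hx : 0 ≤ x) :
    A ^ x * Real.exp (-A) ≤ Real.Gamma (x + 1) := by
  rw [Real.Gamma_eq_integral (by linarith), ← integral_exp_neg_Ioi, ← integral_const_mul]
  have hInt := Real.GammaIntegral_convergent (s := x + 1) (by linarith)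
  have hsub : Ioi A ⊆ Ioi (0 : ℝ) := Ioi_subset_Ioi hA
  calc ∫ t in Ioi A, A ^ x * Real.exp (-t)
      ≤ ∫ t in Ioi A, Real.exp (-t) * t ^ (x + 1 - 1) := by
        refine setIntegral_mono_on ((integrableOn_exp_neg_Ioi A).const_mul _)
          (hInt.mono_set hsub) measurableSet_Ioi fun t ht => ?_
        rw [add_sub_cancel_right, mul_comm]
        exact mul_le_mul_of_nonneg_left (Real.rpow_le_rpow hA ht.le hx) (Real.exp_pos _).le
    _ ≤ ∫ t in Ioi 0, Real.exp (-t) * t ^ (x + 1 - 1) := by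
        refine setIntegral_mono_set hInt ?_ hsub.eventuallyLE
        filter_upwards [self_mem_ae_restrict measurableSet_Ioi] with t ht
        exact mul_nonneg (Real.exp_pos _).le (Real.rpow_nonneg (le_of_lt ht) _)

variable {α : ℝ}

theorem abs_mittagLeffler_term_le (hα : 0 < α) {t : ℝ} (ht : 0 < t) (n : ℕ) :
    |(-(t ^ α)) ^ n / Real.Gamma (α * n + 1)| ≤ Real.exp (2 * t) * ((2 : ℝ) ^ (-α)) ^ n := by
  have hn : 0 ≤ α * n := by positivity
  have hG : 0 < Real.Gamma (α * n + 1) := Real.Gamma_pos_of_pos (by linarith)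
  have key := Real.rpow_mul_exp_neg_le_Gamma (A := 2 * t) (by positivity) hn
  rw [abs_div, abs_pow, abs_neg, abs_of_pos (Real.rpow_pos_of_pos ht α), abs_of_pos hG,
    div_le_iff₀ hG, ← Real.rpow_natCast, ← Real.rpow_mul ht.le, ← Real.rpow_natCast,
    ← Real.rpow_mul zero_le_two]
  calc t ^ (α * n) = Real.exp (2 * t) * 2 ^ (-α * n) * ((2 * t) ^ (α * n) * Real.exp (-(2 * t))) := by
        rw [Real.mul_rpow zero_le_two ht.le, neg_mul, Real.rpow_neg zero_le_two, Real.exp_neg]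
        field_simp
    _ ≤ _ := by gcongr

theorem two_rpow_neg_lt_one (hα : 0 < α) : (2 : ℝ) ^ (-α) < 1 :=
  Real.rpow_lt_one_of_one_lt_of_neg one_lt_two (by linarith)

theorem summable_two_rpow_neg_pow (hα : 0 < α) : Summable fun n : ℕ => ((2 : ℝ) ^ (-α)) ^ n :=
  summable_geometric_of_lt_one (by positivity) (two_rpow_neg_lt_one hα)

theorem hasSum_mittagLeffler_neg_rpow (hα : 0 < α) {t : ℝ} (ht : 0 < t) :
    HasSum (fun n : ℕ => (-(t ^ α)) ^ n / Real.Gamma (α * n + 1))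
      (mittagLeffler α (-(t ^ α))) :=
  (Summable.of_norm_bounded ((summable_two_rpow_neg_pow hα).mul_left _)
    (abs_mittagLeffler_term_le hα ht)).hasSum

theorem abs_mittagLeffler_le_exp (hα : 0 < α) {t : ℝ} (ht : 0 < t) :
    |mittagLeffler α (-(t ^ α))| ≤ (1 - (2 : ℝ) ^ (-α))⁻¹ * Real.exp (2 * t) := by
  have h := ((hasSum_geometric_of_lt_one (by positivity)
    (two_rpow_neg_lt_one hα)).mul_left (Real.exp (2 * t)))
  rw [mul_comm]
  rw [← (hasSum_mittagLeffler_neg_rpow hα ht).tsum_eq, ← Real.norm_eq_abs]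
  exact tsum_of_norm_bounded h fun n =>
    (Real.norm_eq_abs _).trans_le (abs_mittagLeffler_term_le hα ht n)

theorem continuousOn_mittagLeffler_neg_rpow (hα : 0 < α) :
    ContinuousOn (fun t : ℝ => mittagLeffler α (-(t ^ α))) (Ioi 0) := by
  refine continuousOn_of_locally_continuousOn fun x hx => ⟨Iio (x + 1), isOpen_Iio, by simp, ?_⟩
  refine continuousOn_tsum (u := fun n => Real.exp (2 * (x + 1)) * ((2 : ℝ) ^ (-α)) ^ n)
    (fun n => ?_) ((summable_two_rpow_neg_pow hα).mul_left _) fun n t ht => ?_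
  · refine ((ContinuousOn.neg fun t ht => ?_).pow n).div_const _
    exact (Real.continuousAt_rpow_const t α (Or.inl ht.1.ne')).continuousWithinAt
  · refine (abs_mittagLeffler_term_le hα ht.1 n).trans ?_
    have := ht.2.out.le
    gcongr

/-- The Laplace transform of `t ↦ E_α(-t ^ α)` on a real half-line of convergence. -/
theorem integral_exp_neg_mul_mittagLeffler (hα : 0 < α) {s : ℝ} (hs : 2 < s) :
    ∫ t in Ioi 0, Real.exp (-s * t) * mittagLeffler α (-(t ^ α)) = s ^ (α - 1) / (s ^ α + 1) := by
  have hs0 : 0 < s := by linarith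
  have hsα : 0 < s ^ α := Real.rpow_pos_of_pos hs0 α
  have hsum := hasSum_integral_of_dominated_convergence (μ := volume.restrict (Ioi (0 : ℝ)))
    (F := fun (n : ℕ) t => Real.exp (-s * t) * ((-(t ^ α)) ^ n / Real.Gamma (α * n + 1)))
    (f := fun t => Real.exp (-s * t) * mittagLeffler α (-(t ^ α)))
    (fun n t => Real.exp (-(s - 2) * t) * ((2 : ℝ) ^ (-α)) ^ n)
    (fun n => Measurable.aestronglyMeasurable (by fun_prop)) ?_ ?_ ?_ ?_
  · have hterm (n : ℕ) : ∫ t in Ioi 0, Real.exp (-s * t) *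
        ((-(t ^ α)) ^ n / Real.Gamma (α * n + 1)) = s⁻¹ * (-(s ^ α)⁻¹) ^ n := by
      have hG : 0 < Real.Gamma (α * n + 1) := Real.Gamma_pos_of_pos (by positivity)
      have := Real.integral_rpow_mul_exp_neg_mul_Ioi (a := α * n + 1) (by positivity) hs0
      calc _ = ∫ t in Ioi 0, (-1) ^ n / Real.Gamma (α * n + 1) *
            (t ^ (α * n + 1 - 1) * Real.exp (-(s * t))) := by
            refine setIntegral_congr_fun measurableSet_Ioi fun t ht => ?_
            rw [add_sub_cancel_right, Real.rpow_mul (le_of_lt ht), Real.rpow_natCast, neg_pow,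
              neg_mul]
            ring
        _ = _ := by
            rw [integral_const_mul, this, Real.rpow_add (by positivity), Real.rpow_one,
              Real.rpow_mul (by positivity), Real.rpow_natCast, one_div, Real.inv_rpow hs0.le,
              neg_pow (s ^ α)⁻¹]
            field_simp
    simp_rw [hterm] at hsum
    have hlt : |(-(s ^ α)⁻¹)| < 1 := by
      rw [abs_neg, abs_of_pos (inv_pos.2 hsα)]
      exact inv_lt_one_of_one_lt₀ (Real.one_lt_rpow (by linarith) hα)
    rw [hsum.unique ((hasSum_geometric_of_abs_lt_one hlt).mul_left _), Real.rpow_sub hs0,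
      Real.rpow_one, show 1 - -(s ^ α)⁻¹ = (s ^ α + 1) / s ^ α by field_simp; ring]
    field_simp
  · intro n
    filter_upwards [self_mem_ae_restrict measurableSet_Ioi] with t ht
    rw [norm_mul, Real.norm_of_nonneg (Real.exp_pos _).le,
      show -(s - 2) * t = -s * t + 2 * t by ring, Real.exp_add, mul_assoc]
    exact mul_le_mul_of_nonneg_left (abs_mittagLeffler_term_le hα ht n) (Real.exp_pos _).le
  · exact .of_forall fun t => (summable_two_rpow_neg_pow hα).mul_left _
  · simp_rw [tsum_mul_left]
    exact (integrableOn_exp_mul_Ioi (by linarith) 0).mul_const _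
  · filter_upwards [self_mem_ae_restrict measurableSet_Ioi] with t ht
    exact (hasSum_mittagLeffler_neg_rpow hα ht).mul_left _

end MittagLefflerSeries

section LaplaceTransform

variable {f : ℝ → ℝ} {C c : ℝ}

theorem norm_cexp_neg_mul_mul_le (hb : ∀ t > 0, |f t| ≤ C * Real.exp (c * t)) (s : ℂ) {t : ℝ}
    (ht : 0 < t) : ‖Complex.exp (-s * t) * f t‖ ≤ C * Real.exp (-(s.re - c) * t) := by
  have h : (-s * t).re = -s.re * t := by simp
  rw [norm_mul, Complex.norm_exp, h, Complex.norm_real, Real.norm_eq_abs]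
  calc _ ≤ Real.exp (-s.re * t) * (C * Real.exp (c * t)) := by gcongr; exact hb t ht
    _ = _ := by rw [show -(s.re - c) * t = -s.re * t + c * t by ring, Real.exp_add]; ring

theorem aestronglyMeasurable_cexp_neg_mul_mul (hf : ContinuousOn f (Ioi 0)) (s : ℂ) :
    AEStronglyMeasurable (fun t : ℝ => Complex.exp (-s * t) * f t) (volume.restrict (Ioi 0)) :=
  (Continuous.aestronglyMeasurable (by fun_prop)).mul
    (Complex.continuous_ofReal.comp_aestronglyMeasurable
      (hf.aestronglyMeasurable measurableSet_Ioi))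

theorem integrableOn_cexp_neg_mul_mul (hf : ContinuousOn f (Ioi 0))
    (hb : ∀ t > 0, |f t| ≤ C * Real.exp (c * t)) {s : ℂ} (hs : c < s.re) :
    IntegrableOn (fun t : ℝ => Complex.exp (-s * t) * f t) (Ioi 0) := by
  refine Integrable.mono' ((integrableOn_exp_mul_Ioi (a := -(s.re - c)) (by linarith) 0).const_mul C)
    (aestronglyMeasurable_cexp_neg_mul_mul hf s) ?_
  filter_upwards [self_mem_ae_restrict measurableSet_Ioi] with t ht
  exact norm_cexp_neg_mul_mul_le hb s ht

theorem differentiableOn_laplace (hf : ContinuousOn f (Ioi 0))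
    (hb : ∀ t > 0, |f t| ≤ C * Real.exp (c * t)) :
    DifferentiableOn ℂ (fun s : ℂ => ∫ t : ℝ in Ioi 0, Complex.exp (-s * t) * f t)
      {s | c < s.re} := by
  intro s₀ hs₀
  have hC : 0 ≤ C := by
    have := (abs_nonneg _).trans (hb 1 one_pos)
    exact nonneg_of_mul_nonneg_left this (Real.exp_pos _)
  set δ := (s₀.re - c) / 2 with hδ
  have hδ0 : 0 < δ := by have : c < s₀.re := hs₀; linarith
  refine (hasDerivAt_integral_of_dominated_loc_of_deriv_le (Metric.ball_mem_nhds s₀ hδ0)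
    (F' := fun s t => -t * (Complex.exp (-s * t) * f t))
    (bound := fun t => C * (2 / δ) * Real.exp (-(δ / 2) * t))
    (.of_forall (aestronglyMeasurable_cexp_neg_mul_mul hf))
    (integrableOn_cexp_neg_mul_mul hf hb hs₀)
    ((Continuous.aestronglyMeasurable (by fun_prop)).mul
      (aestronglyMeasurable_cexp_neg_mul_mul hf s₀)) ?_
    ((integrableOn_exp_mul_Ioi (by linarith) 0).const_mul _) ?_).2.differentiableAt.differentiableWithinAt
  · filter_upwards [self_mem_ae_restrict measurableSet_Ioi] with t ht s hs
    have ht0 : (0 : ℝ) < t := ht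
    have hre : δ ≤ s.re - c := by
      have h1 := (Complex.abs_re_le_norm (s - s₀)).trans_lt (mem_ball_iff_norm.1 hs)
      rw [Complex.sub_re, abs_lt] at h1
      linarith [h1.1]
    have h2 : t ≤ 2 / δ * Real.exp (δ / 2 * t) := by
      have := Real.add_one_le_exp (δ / 2 * t)
      calc t = 2 / δ * (δ / 2 * t) := by field_simp
        _ ≤ _ := by gcongr; linarith
    rw [norm_mul, norm_neg, Complex.norm_real, Real.norm_of_nonneg ht0.le]
    calc _ ≤ 2 / δ * Real.exp (δ / 2 * t) * (C * Real.exp (-δ * t)) := by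
          refine mul_le_mul h2 ((norm_cexp_neg_mul_mul_le hb s ht).trans ?_) (norm_nonneg _)
            (by positivity)
          gcongr
      _ = _ := by
          rw [show -(δ / 2) * t = δ / 2 * t + -δ * t by ring, Real.exp_add]; ring
  · refine .of_forall fun t s _ => ?_
    have h := (((hasDerivAt_id s).neg.mul_const (t : ℂ)).cexp).mul_const (f t : ℂ)
    convert! h using 1
    simp
    ring

/-- Identity theorem for Laplace transforms. -/
theorem laplace_eqOn_of_real (hf : ContinuousOn f (Ioi 0))
    (hb : ∀ t > 0, |f t| ≤ C * Real.exp (c * t)) {P : ℂ → ℂ} {d : ℝ} (hcd : c ≤ d)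
    (hP : DifferentiableOn ℂ P {s | c < s.re})
    (heq : ∀ s : ℝ, d < s → ∫ t : ℝ in Ioi 0, Complex.exp (-(s : ℂ) * t) * f t = P s) :
    EqOn (fun s : ℂ => ∫ t : ℝ in Ioi 0, Complex.exp (-s * t) * f t) P {s | c < s.re} := by
  have hopen : IsOpen {s : ℂ | c < s.re} := isOpen_lt continuous_const Complex.continuous_re
  refine AnalyticOnNhd.eqOn_of_preconnected_of_frequently_eq (z₀ := ((d + 1 : ℝ) : ℂ))
    ((differentiableOn_laplace hf hb).analyticOnNhd hopen) (hP.analyticOnNhd hopen)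
    (convex_halfSpace_re_gt c).isPreconnected (by simp; linarith) ?_
  have htend : Tendsto (fun x : ℝ => (x : ℂ)) (𝓝[≠] (d + 1)) (𝓝[≠] ((d + 1 : ℝ) : ℂ)) :=
    tendsto_nhdsWithin_iff.2
      ⟨Complex.continuous_ofReal.continuousAt.tendsto.mono_left nhdsWithin_le_nhds,
        eventually_nhdsWithin_of_forall fun x hx => Complex.ofReal_injective.ne hx⟩
  refine htend.frequently (Eventually.frequently ?_)
  filter_upwards [nhdsWithin_le_nhds (Ioi_mem_nhds (lt_add_one d))] with x hx
  exact heq x hx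

end LaplaceTransform

section VerticalLines

/-- The contour of a vertical integral may be shifted within a strip where the integrand is
holomorphic and bounded by an integrable function of the ordinate tending to zero. -/
theorem integral_vertical_eq_of_norm_le {F : ℂ → ℂ} {g : ℝ → ℝ} {a b : ℝ} (hab : a ≤ b)
    (hF : DifferentiableOn ℂ F {s | a ≤ s.re}) (hg : Integrable g)
    (hg_top : Tendsto g atTop (𝓝 0)) (hg_even : ∀ y, g (-y) = g y)
    (hFg : ∀ x ∈ Icc a b, ∀ y : ℝ, y ≠ 0 → ‖F (x + y * Complex.I)‖ ≤ g y) :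
    ∫ y : ℝ, F (a + y * Complex.I) = ∫ y : ℝ, F (b + y * Complex.I) := by
  have hInt (x : ℝ) (hx : x ∈ Icc a b) : Integrable fun y : ℝ => F (x + y * Complex.I) := by
    refine hg.mono' (Continuous.aestronglyMeasurable ?_) ?_
    · exact hF.continuousOn.comp_continuous (by fun_prop) fun y => by simpa using hx.1
    · filter_upwards [compl_mem_ae_iff.2 (measure_singleton (0 : ℝ))] with y hy
      exact hFg x hx y hy
  have hlim (x : ℝ) (hx : x ∈ Icc a b) := intervalIntegral_tendsto_integral (hInt x hx)
    tendsto_neg_atTop_atBot tendsto_id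
  have hhor (σ : ℝ → ℝ) (hσ : ∀ T, g (σ T) = g T) (hσ0 : ∀ T > 0, σ T ≠ 0) :
      Tendsto (fun T : ℝ => ∫ x : ℝ in a..b, F (x + σ T * Complex.I)) atTop (𝓝 0) := by
    refine squeeze_zero_norm' ?_ (by simpa using hg_top.mul_const |b - a|)
    filter_upwards [eventually_gt_atTop 0] with T hT
    refine intervalIntegral.norm_integral_le_of_norm_le_const fun x hx => ?_
    rw [uIoc_of_le hab] at hx
    rw [← hσ T]
    exact hFg x (Ioc_subset_Icc_self hx) _ (hσ0 T hT)
  have hrect (T : ℝ) : Complex.I • (∫ y : ℝ in -T..T, F (a + y * Complex.I)) =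
      (∫ x : ℝ in a..b, F (x + (-T : ℝ) * Complex.I)) -
      (∫ x : ℝ in a..b, F (x + T * Complex.I)) +
      Complex.I • ∫ y : ℝ in -T..T, F (b + y * Complex.I) := by
    have h := Complex.integral_boundary_rect_eq_zero_of_differentiableOn F
      ⟨a, -T⟩ ⟨b, T⟩ (hF.mono fun s hs => ?_)
    · exact (sub_eq_zero.1 h).symm
    · rw [Complex.mem_reProdIm] at hs
      simpa [hab] using (uIcc_of_le hab ▸ hs.1).1
  have h1 := (hlim a (left_mem_Icc.2 hab)).const_smul Complex.I
  have h2 := ((hhor (fun T => -T) hg_even (by intro T hT; linarith [neg_ne_zero.2 hT.ne'])).sub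
    (hhor id (fun _ => rfl) fun T hT => hT.ne')).add
    ((hlim b (right_mem_Icc.2 hab)).const_smul Complex.I)
  simp only [id_eq] at h1 h2
  simp_rw [← hrect, sub_zero, zero_add] at h2
  exact smul_right_injective ℂ Complex.I_ne_zero (tendsto_nhds_unique h1 h2)

end VerticalLines

section Resolvent

variable {α : ℝ}

theorem exists_mul_max_le_norm_cpow_add_one (hα : α ∈ Ioo (0 : ℝ) 2) :
    ∃ κ > 0, ∀ s : ℂ, 0 ≤ s.re → κ * max 1 (‖s‖ ^ α) ≤ ‖s ^ (α : ℂ) + 1‖ := by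
  set θ := Real.pi / 2 * α with hθ
  have hπ := Real.pi_pos
  have hθ0 : 0 < θ := mul_pos (by linarith) hα.1
  have hθπ : θ < Real.pi := by rw [hθ]; nlinarith [hα.2]
  have hcos : 0 < 1 + Real.cos θ := by
    have := Real.cos_lt_cos_of_nonneg_of_le_pi hθ0.le le_rfl hθπ
    rw [Real.cos_pi] at this
    linarith
  refine ⟨min 1 (1 + Real.cos θ), lt_min one_pos hcos, fun s hs => ?_⟩
  set κ := min 1 (1 + Real.cos θ)
  have hκ0 : 0 < κ := lt_min one_pos hcos
  have hκ1 : κ ≤ 1 := min_le_left _ _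
  have hκ2 : κ ≤ 1 + Real.cos θ := min_le_right _ _
  set r := ‖s‖ ^ α
  have hr : 0 ≤ r := by positivity
  have harg : |s.arg * α| ≤ θ := by
    rw [abs_mul, abs_of_pos hα.1]
    exact mul_le_mul_of_nonneg_right (Complex.abs_arg_le_pi_div_two_iff.2 hs) hα.1.le
  have hc : Real.cos θ ≤ Real.cos (s.arg * α) := by
    rw [← Real.cos_abs (s.arg * α)]
    exact Real.cos_le_cos_of_nonneg_of_le_pi (abs_nonneg _) hθπ.le harg
  have hsq : ‖s ^ (α : ℂ) + 1‖ ^ 2 = r ^ 2 + 2 * r * Real.cos (s.arg * α) + 1 := by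
    have hsc := Real.sin_sq_add_cos_sq (s.arg * α)
    rw [Complex.sq_norm, Complex.cpow_ofReal, Complex.normSq_apply]
    generalize Real.cos (s.arg * α) = x at hsc ⊢
    generalize Real.sin (s.arg * α) = y at hsc ⊢
    simp only [Complex.add_re, Complex.add_im, Complex.re_ofReal_mul, Complex.im_ofReal_mul,
      Complex.ofReal_re, Complex.ofReal_im, Complex.I_re, Complex.I_im, Complex.one_re,
      Complex.one_im]
    linear_combination r ^ 2 * hsc
  have hlow : κ * (r ^ 2 + 1) ≤ ‖s ^ (α : ℂ) + 1‖ ^ 2 := by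
    rw [hsq]
    nlinarith [sq_nonneg (r - 1), mul_nonneg hr (sub_nonneg.2 hc)]
  refine le_of_sq_le_sq ?_ (norm_nonneg _)
  rw [mul_pow]
  have hmax : max 1 r ^ 2 ≤ r ^ 2 + 1 := by
    rcases max_cases 1 r with ⟨h, _⟩ | ⟨h, _⟩ <;> rw [h] <;> nlinarith
  calc κ ^ 2 * max 1 r ^ 2 ≤ κ * (r ^ 2 + 1) := by
        gcongr
        nlinarith
    _ ≤ _ := hlow

theorem cpow_add_one_ne_zero_of_re_nonneg (hα : α ∈ Ioo (0 : ℝ) 2) {s : ℂ} (hs : 0 ≤ s.re) :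
    s ^ (α : ℂ) + 1 ≠ 0 := by
  obtain ⟨κ, hκ, h⟩ := exists_mul_max_le_norm_cpow_add_one hα
  have := h s hs
  exact norm_pos_iff.1 (lt_of_lt_of_le (by positivity) this)

theorem differentiableOn_cpow_div_cpow_add_one (hα : α ∈ Ioo (0 : ℝ) 2) :
    DifferentiableOn ℂ (fun s : ℂ => s ^ ((α - 1 : ℝ) : ℂ) / (s ^ (α : ℂ) + 1)) {s | 0 < s.re} := by
  intro s hs
  have hs' : s ∈ Complex.slitPlane := Or.inl hs
  refine DifferentiableAt.differentiableWithinAt (.div ?_ ?_ ?_)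
  · exact differentiableAt_id.cpow_const hs'
  · exact (differentiableAt_id.cpow_const hs').add_const _
  · exact cpow_add_one_ne_zero_of_re_nonneg hα (le_of_lt hs)

/-- An even integrable majorant on vertical lines, decaying at infinity. -/
noncomputable def verticalMajorant (γ y : ℝ) : ℝ :=
  min (|y| ^ (γ - 1)) (|y| ^ (-γ - 1))

theorem tendsto_verticalMajorant {γ : ℝ} (hγ : 0 < γ) :
    Tendsto (verticalMajorant γ) atTop (𝓝 0) := by
  have h := (tendsto_rpow_neg_atTop (show 0 < γ + 1 by linarith)).comp tendsto_abs_atTop_atTop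
  refine squeeze_zero (fun y => ?_) (fun y => ?_) h
  · exact le_min (by positivity) (by positivity)
  · exact (min_le_right _ _).trans_eq (by simp; ring_nf)

theorem integrable_verticalMajorant {γ : ℝ} (hγ : 0 < γ) : Integrable (verticalMajorant γ) := by
  have hmeas : Measurable (verticalMajorant γ) := by unfold verticalMajorant; fun_prop
  have hnonneg (y : ℝ) : 0 ≤ verticalMajorant γ y := le_min (by positivity) (by positivity)
  have hIoi : IntegrableOn (verticalMajorant γ) (Ioi 0) := by
    rw [← Ioc_union_Ioi_eq_Ioi zero_le_one]
    refine IntegrableOn.union ?_ ?_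
    · have h := (intervalIntegral.intervalIntegrable_rpow' (a := 0) (b := 1)
        (r := γ - 1) (by linarith)).1
      refine h.mono' hmeas.aestronglyMeasurable ?_
      filter_upwards [self_mem_ae_restrict measurableSet_Ioc] with y hy
      rw [Real.norm_of_nonneg (hnonneg y)]
      exact (min_le_left _ _).trans_eq (by rw [abs_of_pos hy.1])
    · refine (integrableOn_Ioi_rpow_of_lt (a := -γ - 1) (by linarith) one_pos).mono'
        hmeas.aestronglyMeasurable ?_
      filter_upwards [self_mem_ae_restrict measurableSet_Ioi] with y hy
      rw [Real.norm_of_nonneg (hnonneg y)]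
      exact (min_le_right _ _).trans_eq (by rw [abs_of_pos (one_pos.trans hy)])
  have hind := (integrable_indicator_iff measurableSet_Ioi).2 hIoi
  refine (hind.add hind.comp_neg).mono' hmeas.aestronglyMeasurable ?_
  filter_upwards [compl_mem_ae_iff.2 (measure_singleton (0 : ℝ))] with y hy
  rw [Real.norm_of_nonneg (hnonneg y)]
  rcases lt_or_gt_of_ne (show y ≠ 0 from hy) with h | h
  · simp [h, h.le, verticalMajorant]
  · simp [h, h.le, verticalMajorant]

theorem exists_norm_cpow_div_sub_inv_le (hα : α ∈ Ioo (0 : ℝ) 2) :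
    ∃ K, ∀ s : ℂ, 0 ≤ s.re → s.im ≠ 0 →
      ‖s ^ ((α - 1 : ℝ) : ℂ) / (s ^ (α : ℂ) + 1) - (s + 1)⁻¹‖ ≤
        K * verticalMajorant (min α 1) s.im := by
  obtain ⟨κ, hκ, hlow⟩ := exists_mul_max_le_norm_cpow_add_one hα
  refine ⟨2 / κ, fun s hs him => ?_⟩
  set γ := min α 1
  have hγ0 : 0 < γ := lt_min hα.1 one_pos
  have hγα : γ ≤ α := min_le_left _ _
  have hγ1 : γ ≤ 1 := min_le_right _ _
  have hs0 : s ≠ 0 := fun h => him (by simp [h])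
  set r := ‖s‖
  have hr : 0 < r := norm_pos_iff.2 hs0
  have hne := cpow_add_one_ne_zero_of_re_nonneg hα hs
  have hne1 : s + 1 ≠ 0 := fun h => by
    have := congrArg Complex.re h
    simp at this
    linarith
  have hs1 : max 1 r ≤ ‖s + 1‖ := by
    have h2 : ‖s + 1‖ ^ 2 = r ^ 2 + 2 * s.re + 1 := by
      rw [Complex.sq_norm, show r ^ 2 = _ from Complex.sq_norm s, Complex.normSq_apply,
        Complex.normSq_apply]
      simp
      ring
    refine max_le ?_ ?_ <;> refine le_of_sq_le_sq ?_ (norm_nonneg _) <;> nlinarith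
  have heq : s ^ ((α - 1 : ℝ) : ℂ) / (s ^ (α : ℂ) + 1) - (s + 1)⁻¹ =
      (s ^ ((α - 1 : ℝ) : ℂ) - 1) / ((s ^ (α : ℂ) + 1) * (s + 1)) := by
    have : s ^ (α : ℂ) = s ^ ((α - 1 : ℝ) : ℂ) * s := by
      rw [Complex.ofReal_sub, Complex.cpow_sub _ _ hs0]
      simp [hs0]
    rw [inv_eq_one_div, div_sub_div _ _ hne hne1]
    congr 1
    rw [this]
    ring
  have hnum : ‖s ^ ((α - 1 : ℝ) : ℂ) - 1‖ ≤ r ^ (α - 1) + 1 :=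
    (norm_sub_le _ _).trans_eq (by rw [Complex.norm_cpow_real, norm_one])
  have hmain : (r ^ (α - 1) + 1) / (max 1 (r ^ α) * max 1 r) ≤
      2 * min (r ^ (γ - 1)) (r ^ (-γ - 1)) := by
    rcases le_total r 1 with h | h
    · have e1 : r ^ (α - 1) ≤ r ^ (γ - 1) := Real.rpow_le_rpow_of_exponent_ge hr h (by linarith)
      have e2 : 1 ≤ r ^ (γ - 1) := Real.one_le_rpow_of_pos_of_le_one_of_nonpos hr h (by linarith)
      have e3 : r ^ (γ - 1) ≤ r ^ (-γ - 1) :=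
        Real.rpow_le_rpow_of_exponent_ge hr h (by linarith)
      rw [min_eq_left e3]
      refine (div_le_self (by positivity) ?_).trans (by linarith)
      exact one_le_mul_of_one_le_of_one_le (le_max_left _ _) (le_max_left _ _)
    · have e3 : r ^ (-γ - 1) ≤ r ^ (γ - 1) := Real.rpow_le_rpow_of_exponent_le h (by linarith)
      rw [min_eq_right e3]
      have e4 : r ^ α * r ≤ max 1 (r ^ α) * max 1 r := by gcongr <;> exact le_max_right _ _
      have e5 : r ^ (-(2 : ℝ)) ≤ r ^ (-γ - 1) := Real.rpow_le_rpow_of_exponent_le h (by linarith)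
      have e6 : r ^ (-α - 1) ≤ r ^ (-γ - 1) := Real.rpow_le_rpow_of_exponent_le h (by linarith)
      calc _ ≤ (r ^ (α - 1) + 1) / (r ^ α * r) := by gcongr
        _ = r ^ (-(2 : ℝ)) + r ^ (-α - 1) := by
            rw [add_div, ← Real.rpow_add_one hr.ne', ← Real.rpow_sub hr, one_div,
              ← Real.rpow_neg hr.le]
            congr 2 <;> ring
        _ ≤ _ := by linarith
  have hmono : min (r ^ (γ - 1)) (r ^ (-γ - 1)) ≤ verticalMajorant γ s.im := by
    have h1 : |s.im| ≤ r := Complex.abs_im_le_norm s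
    have h2 : 0 < |s.im| := abs_pos.2 him
    exact min_le_min (Real.rpow_le_rpow_of_nonpos h2 h1 (by linarith))
      (Real.rpow_le_rpow_of_nonpos h2 h1 (by linarith))
  rw [heq, norm_div, norm_mul]
  calc _ ≤ (r ^ (α - 1) + 1) / (κ * max 1 (r ^ α) * max 1 r) := by
        gcongr
        exact hlow s hs
    _ = 1 / κ * ((r ^ (α - 1) + 1) / (max 1 (r ^ α) * max 1 r)) := by field_simp
    _ ≤ 1 / κ * (2 * verticalMajorant γ s.im) := by gcongr; exact hmain.trans (by gcongr)
    _ = _ := by ring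

end Resolvent

section Boundedness

variable {α : ℝ}

theorem laplace_mittagLeffler (hα : α ∈ Ioo (0 : ℝ) 2) {C c : ℝ} (hc0 : 0 ≤ c) (hc2 : c ≤ 2)
    (hb : ∀ t > 0, |mittagLeffler α (-(t ^ α))| ≤ C * Real.exp (c * t)) {s : ℂ} (hs : c < s.re) :
    ∫ t : ℝ in Ioi 0, Complex.exp (-s * t) * mittagLeffler α (-(t ^ α)) =
      s ^ ((α - 1 : ℝ) : ℂ) / (s ^ (α : ℂ) + 1) := by
  refine laplace_eqOn_of_real (continuousOn_mittagLeffler_neg_rpow hα.1) hb hc2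
    ((differentiableOn_cpow_div_cpow_add_one hα).mono fun s hs => hc0.trans_lt hs)
    (fun x hx => ?_) hs
  have hx0 : 0 ≤ x := by linarith
  rw [← Complex.ofReal_cpow hx0, ← Complex.ofReal_cpow hx0, ← Complex.ofReal_one,
    ← Complex.ofReal_add, ← Complex.ofReal_div, ← integral_exp_neg_mul_mittagLeffler hα.1 hx,
    ← integral_complex_ofReal]
  simp

theorem laplace_mittagLeffler_sub_exp (hα : α ∈ Ioo (0 : ℝ) 2) {s : ℂ} (hs : 2 < s.re) :
    ∫ t : ℝ in Ioi 0, Complex.exp (-s * t) *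
        ((mittagLeffler α (-(t ^ α)) - Real.exp (-t) : ℝ) : ℂ) =
      s ^ ((α - 1 : ℝ) : ℂ) / (s ^ (α : ℂ) + 1) - (s + 1)⁻¹ := by
  have hb := fun t => abs_mittagLeffler_le_exp (t := t) hα.1
  have hre : (-(s + 1)).re < 0 := by simp; linarith
  have hexp : ∀ t : ℝ, Complex.exp (-s * t) * (Real.exp (-t) : ℝ) =
      Complex.exp (-(s + 1) * t) := fun t => by
    rw [Complex.ofReal_exp, ← Complex.exp_add]
    congr 1
    push_cast
    ring
  rw [← laplace_mittagLeffler hα zero_le_two le_rfl hb hs]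
  have h1 : ∫ t : ℝ in Ioi 0, Complex.exp (-s * t) * (Real.exp (-t) : ℝ) = (s + 1)⁻¹ := by
    simp_rw [hexp]
    rw [integral_exp_mul_complex_Ioi hre]
    rw [Complex.ofReal_zero, mul_zero, Complex.exp_zero, neg_div_neg_eq, one_div]
  rw [← h1, ← integral_sub]
  · simp_rw [Complex.ofReal_sub, mul_sub]
  · exact integrableOn_cexp_neg_mul_mul (continuousOn_mittagLeffler_neg_rpow hα.1) hb hs
  · simp_rw [hexp]
    exact integrableOn_exp_mul_complex_Ioi hre 0

/-- The Bromwich integral, in the Fourier normalisation, on the abscissa `3`. -/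
theorem mittagLeffler_sub_exp_eq_integral (hα : α ∈ Ioo (0 : ℝ) 2) {G : ℂ → ℂ}
    (hG : G = fun s => s ^ ((α - 1 : ℝ) : ℂ) / (s ^ (α : ℂ) + 1) - (s + 1)⁻¹)
    (hGint : Integrable fun y : ℝ => G ((3 : ℝ) + y * Complex.I)) {t : ℝ} (ht : 0 < t) :
    ((mittagLeffler α (-(t ^ α)) - Real.exp (-t) : ℝ) : ℂ) = (2 * Real.pi : ℝ)⁻¹ •
      ∫ y : ℝ, Complex.exp (((3 : ℝ) + y * Complex.I) * t) * G ((3 : ℝ) + y * Complex.I) := by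
  set f : ℝ → ℝ := fun t => mittagLeffler α (-(t ^ α)) - Real.exp (-t)
  have hf : ContinuousOn f (Ioi 0) :=
    (continuousOn_mittagLeffler_neg_rpow hα.1).sub (by fun_prop)
  have hb : ∀ t > 0, |f t| ≤ ((1 - (2 : ℝ) ^ (-α))⁻¹ + 1) * Real.exp (2 * t) := fun t ht => by
    refine (abs_sub _ _).trans ?_
    rw [add_mul, one_mul, abs_of_pos (Real.exp_pos _)]
    gcongr
    · exact abs_mittagLeffler_le_exp hα.1 ht
    · linarith
  set φ : ℝ → ℂ := (Ioi 0).indicator fun t => Complex.exp (-(3 : ℂ) * t) * f t with hφ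
  have hφint : Integrable φ := (integrable_indicator_iff measurableSet_Ioi).2
    (integrableOn_cexp_neg_mul_mul hf hb (by norm_num))
  have hπ : (0 : ℝ) < 2 * Real.pi := by positivity
  have hfour : FourierTransform.fourier φ =
      fun w : ℝ => G ((3 : ℝ) + (2 * Real.pi * w : ℝ) * Complex.I) := by
    ext w
    rw [Real.fourier_real_eq_integral_exp_smul, hG]
    simp only
    rw [← laplace_mittagLeffler_sub_exp hα (by simp; norm_num), ← integral_indicator measurableSet_Ioi]
    congr 1
    ext v
    by_cases hv : v ∈ Ioi (0 : ℝ)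
    · rw [hφ, indicator_of_mem hv, indicator_of_mem hv, smul_eq_mul, ← mul_assoc,
        ← Complex.exp_add]
      congr 2
      push_cast
      ring
    · rw [hφ, indicator_of_notMem hv, indicator_of_notMem hv, smul_zero]
  have hφt : ContinuousAt φ t := by
    have : φ =ᶠ[𝓝 t] fun t => Complex.exp (-(3 : ℂ) * t) * f t := by
      filter_upwards [Ioi_mem_nhds ht] with v hv using indicator_of_mem hv _
    refine ContinuousAt.congr ?_ this.symm
    exact (by fun_prop : Continuous fun t : ℝ => Complex.exp (-(3 : ℂ) * t)).continuousAt.mul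
      (Complex.continuous_ofReal.continuousAt.comp (hf.continuousAt (Ioi_mem_nhds ht)))
  have hinv := hφint.fourierInv_fourier_eq
    (by rw [hfour]; exact hGint.comp_mul_left' hπ.ne') hφt
  rw [hfour, Real.fourierInv_eq', hφ, indicator_of_mem (show t ∈ Ioi 0 from ht)] at hinv
  have hexp : Complex.exp ((3 : ℂ) * t) * Complex.exp (-(3 : ℂ) * t) = 1 := by
    rw [← Complex.exp_add]
    simp
  have hcv := Measure.integral_comp_mul_left (fun y : ℝ =>
    Complex.exp (((3 : ℝ) + y * Complex.I) * t) * G ((3 : ℝ) + y * Complex.I)) (2 * Real.pi)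
  rw [abs_of_pos (inv_pos.2 hπ)] at hcv
  rw [← hcv]
  calc (f t : ℂ) = Complex.exp ((3 : ℂ) * t) * (Complex.exp (-(3 : ℂ) * t) * f t) := by
        rw [← mul_assoc, hexp, one_mul]
    _ = _ := by
        rw [← hinv, ← integral_const_mul]
        congr 1
        ext w
        rw [smul_eq_mul, ← mul_assoc, ← Complex.exp_add]
        congr 2
        simp only [RCLike.inner_apply, conj_trivial]
        push_cast
        ring

/-- For `0 < α < 2`, the Mittag-Leffler function is bounded on the negative half-line. -/
theorem exists_abs_mittagLeffler_neg_rpow_le (hα : α ∈ Ioo (0 : ℝ) 2) :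
    ∃ M, ∀ t > 0, |mittagLeffler α (-(t ^ α))| ≤ M := by
  obtain ⟨K, hK⟩ := exists_norm_cpow_div_sub_inv_le hα
  set γ := min α 1
  have hγ : 0 < γ := lt_min hα.1 one_pos
  set G : ℂ → ℂ := fun s => s ^ ((α - 1 : ℝ) : ℂ) / (s ^ (α : ℂ) + 1) - (s + 1)⁻¹ with hG
  have hGdiff : DifferentiableOn ℂ G {s | 0 < s.re} := by
    refine (differentiableOn_cpow_div_cpow_add_one hα).sub
      (DifferentiableOn.inv (by fun_prop) fun s hs h => ?_)
    have h1 := congrArg Complex.re h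
    have h2 : 0 < s.re := hs
    simp at h1
    linarith
  have hKG (x : ℝ) (hx : 0 ≤ x) (y : ℝ) (hy : y ≠ 0) :
      ‖G (x + y * Complex.I)‖ ≤ K * verticalMajorant γ y := by
    simpa [hG] using hK (x + y * Complex.I) (by simpa) (by simpa)
  have hne : ∀ᵐ y : ℝ, y ≠ 0 := compl_mem_ae_iff.2 (measure_singleton (0 : ℝ))
  have hmaj := integrable_verticalMajorant hγ
  have hGint : Integrable fun y : ℝ => G ((3 : ℝ) + y * Complex.I) := by
    refine (hmaj.const_mul K).mono' (Continuous.aestronglyMeasurable ?_) ?_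
    · exact hGdiff.continuousOn.comp_continuous (by fun_prop) fun y => by simp
    · filter_upwards [hne] with y hy using hKG 3 (by norm_num) y hy
  have hnorm (t : ℝ) (ht : 0 < t) (x : ℝ) (hx : 0 ≤ x) (y : ℝ) (hy : y ≠ 0) :
      ‖Complex.exp ((x + y * Complex.I) * t) * G (x + y * Complex.I)‖ ≤
        Real.exp (x * t) * (K * verticalMajorant γ y) := by
    rw [norm_mul, Complex.norm_exp]
    have : ((x + y * Complex.I) * t).re = x * t := by simp
    rw [this]
    gcongr
    exact hKG x hx y hy
  set J := ∫ y, K * verticalMajorant γ y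
  refine ⟨(2 * Real.pi)⁻¹ * J + 1, fun t ht => ?_⟩
  have hbound (ε : ℝ) (hε : ε ∈ Ioc (0 : ℝ) 3) :
      |mittagLeffler α (-(t ^ α)) - Real.exp (-t)| ≤ (2 * Real.pi)⁻¹ * (Real.exp (ε * t) * J) := by
    have hshift := integral_vertical_eq_of_norm_le (a := ε) (b := 3)
      (F := fun s => Complex.exp (s * t) * G s)
      (g := fun y => Real.exp (3 * t) * (K * verticalMajorant γ y)) hε.2
      (DifferentiableOn.mul (by fun_prop) (hGdiff.mono fun s hs => hε.1.trans_le hs))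
      ((hmaj.const_mul K).const_mul _)
      (by simpa using ((tendsto_verticalMajorant hγ).const_mul K).const_mul (Real.exp (3 * t)))
      (fun y => by simp [verticalMajorant]) fun x hx y hy => by
        have hx0 : 0 ≤ x := hε.1.le.trans hx.1
        refine (hnorm t ht x hx0 y hy).trans ?_
        have := (norm_nonneg _).trans (hKG x hx0 y hy)
        gcongr
        exact hx.2
    rw [← Real.norm_eq_abs, ← Complex.norm_real, mittagLeffler_sub_exp_eq_integral hα hG hGint ht,
      ← hshift, norm_smul, Real.norm_of_nonneg (by positivity)]
    gcongr
    rw [← integral_const_mul]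
    refine norm_integral_le_of_norm_le ((hmaj.const_mul K).const_mul _) ?_
    filter_upwards [hne] with y hy using hnorm t ht ε hε.1.le y hy
  have hlim : Tendsto (fun ε : ℝ => (2 * Real.pi)⁻¹ * (Real.exp (ε * t) * J)) (𝓝[>] 0)
      (𝓝 ((2 * Real.pi)⁻¹ * J)) := by
    have : Continuous fun ε : ℝ => (2 * Real.pi)⁻¹ * (Real.exp (ε * t) * J) := by fun_prop
    simpa using (this.tendsto 0).mono_left nhdsWithin_le_nhds
  have hle := ge_of_tendsto hlim
    (Filter.eventually_of_mem (Ioc_mem_nhdsGT (by norm_num : (0 : ℝ) < 3)) hbound)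
  have hexp : |Real.exp (-t)| ≤ 1 := by
    rw [abs_of_pos (Real.exp_pos _), Real.exp_le_one_iff]
    linarith
  linarith [abs_sub_abs_le_abs_sub (mittagLeffler α (-(t ^ α))) (Real.exp (-t))]

end Boundedness

section ResolventSums

variable {b c μ ν : ℕ → ℝ} {m : ℝ}

theorem summable_abs_mul_of_abs_le {g : ℕ → ℝ} {M : ℝ} (hb : Summable fun k => |b k|)
    (hg : ∀ k, |g k| ≤ M) : Summable fun k => |b k * g k| :=
  Summable.of_nonneg_of_le (fun _ => abs_nonneg _)
    (fun k => (abs_mul _ _).trans_le (mul_le_mul_of_nonneg_left (hg k) (abs_nonneg _)))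
    (hb.mul_right M)

theorem abs_inv_add_le (hm : 0 < m) {x z : ℝ} (hx : m ≤ x) (hz : 0 ≤ z) : |(z + x)⁻¹| ≤ m⁻¹ := by
  rw [abs_of_pos (inv_pos.2 (by linarith))]
  exact inv_anti₀ hm (by linarith)

theorem abs_inv_le_inv (hm : 0 < m) {x : ℝ} (hx : m ≤ x) : |x⁻¹| ≤ m⁻¹ := by
  simpa using abs_inv_add_le hm hx le_rfl

theorem tendsto_tsum_mul_inv_add (hm : 0 < m) (hμ : ∀ k, m ≤ μ k) (hb : Summable fun k => |b k|) :
    Tendsto (fun z => ∑' k, b k * (z + μ k)⁻¹) (𝓝[>] 0) (𝓝 (∑' k, b k * (μ k)⁻¹)) := by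
  refine tendsto_tsum_of_dominated_convergence (hb.mul_right m⁻¹) (fun k => ?_) ?_
  · have hk : (0 : ℝ) + μ k ≠ 0 := by linarith [hμ k]
    have : ContinuousAt (fun z => b k * (z + μ k)⁻¹) 0 := by fun_prop (disch := exact hk)
    simpa using this.tendsto.mono_left nhdsWithin_le_nhds
  · filter_upwards [self_mem_nhdsWithin] with z hz k
    rw [norm_mul]
    exact mul_le_mul_of_nonneg_left (abs_inv_add_le hm (hμ k) (le_of_lt hz)) (abs_nonneg _)

theorem tsum_mul_inv_mul_inv_add (hm : 0 < m) (hμ : ∀ k, m ≤ μ k) (hb : Summable fun k => |b k|)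
    {z : ℝ} (hz : 0 < z) :
    ∑' k, b k * (μ k)⁻¹ * (z + μ k)⁻¹ =
      z⁻¹ * (∑' k, b k * (μ k)⁻¹ - ∑' k, b k * (z + μ k)⁻¹) := by
  rw [← Summable.tsum_sub
    (summable_abs_mul_of_abs_le hb fun k => abs_inv_le_inv hm (hμ k)).of_abs
    (summable_abs_mul_of_abs_le hb fun k => abs_inv_add_le hm (hμ k) hz.le).of_abs,
    ← tsum_mul_left]
  refine tsum_congr fun k => ?_
  have h1 : 0 < μ k := hm.trans_le (hμ k)
  field_simp
  ring

/-- The sums `∑ b k / (z + μ k)`, `z > 0`, determine the sums `∑ b k / μ k ^ (n + 1)`. -/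
theorem tsum_mul_inv_pow_eq_of_tsum_mul_inv_add_eq (hm : 0 < m) (hμ : ∀ k, m ≤ μ k)
    (hν : ∀ k, m ≤ ν k) (hb : Summable fun k => |b k|) (hc : Summable fun k => |c k|)
    (h : ∀ z > 0, ∑' k, b k * (z + μ k)⁻¹ = ∑' k, c k * (z + ν k)⁻¹) (n : ℕ) :
    ∑' k, b k * (μ k)⁻¹ ^ (n + 1) = ∑' k, c k * (ν k)⁻¹ ^ (n + 1) := by
  induction n generalizing b c with
  | zero =>
    simp only [zero_add, pow_one]
    refine tendsto_nhds_unique (tendsto_tsum_mul_inv_add hm hμ hb)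
      ((tendsto_tsum_mul_inv_add hm hν hc).congr' ?_)
    filter_upwards [self_mem_nhdsWithin] with z hz using (h z hz).symm
  | succ n ih =>
    have h0 : ∑' k, b k * (μ k)⁻¹ = ∑' k, c k * (ν k)⁻¹ := by
      refine tendsto_nhds_unique (tendsto_tsum_mul_inv_add hm hμ hb)
        ((tendsto_tsum_mul_inv_add hm hν hc).congr' ?_)
      filter_upwards [self_mem_nhdsWithin] with z hz using (h z hz).symm
    simp_rw [pow_succ' _ (n + 1), ← mul_assoc]
    refine ih (summable_abs_mul_of_abs_le hb fun k => abs_inv_le_inv hm (hμ k))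
      (summable_abs_mul_of_abs_le hc fun k => abs_inv_le_inv hm (hν k)) fun z hz => ?_
    rw [tsum_mul_inv_mul_inv_add hm hμ hb hz, tsum_mul_inv_mul_inv_add hm hν hc hz, h0, h z hz]

end ResolventSums

section LaplaceOfSeries

variable {α : ℝ}

theorem neg_mul_rpow_eq_neg_rpow (hα : 0 < α) {μ t : ℝ} (hμ : 0 < μ) (ht : 0 < t) :
    -μ * t ^ α = -((μ ^ α⁻¹ * t) ^ α) := by
  rw [Real.mul_rpow (by positivity) ht.le, Real.rpow_inv_rpow hμ.le hα.ne', neg_mul]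

theorem integral_exp_neg_mul_mittagLeffler_neg_mul (hα : α ∈ Ioo (0 : ℝ) 2) {s μ : ℝ} (hs : 0 < s)
    (hμ : 0 < μ) :
    ∫ t in Ioi 0, Real.exp (-s * t) * mittagLeffler α (-μ * t ^ α) =
      s ^ (α - 1) * (s ^ α + μ)⁻¹ := by
  obtain ⟨M, hM⟩ := exists_abs_mittagLeffler_neg_rpow_le hα
  have hunit (x : ℝ) (hx : 0 < x) : ∫ t in Ioi 0, Real.exp (-x * t) * mittagLeffler α (-(t ^ α)) =
      x ^ (α - 1) / (x ^ α + 1) := by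
    have h := laplace_mittagLeffler hα (C := M) (c := 0) le_rfl zero_le_two
      (by simpa using hM) (s := x) (by simpa)
    rw [← Complex.ofReal_cpow hx.le, ← Complex.ofReal_cpow hx.le] at h
    apply Complex.ofReal_injective
    rw [← integral_complex_ofReal]
    push_cast at h ⊢
    exact h
  set r := μ ^ α⁻¹
  have hr : 0 < r := Real.rpow_pos_of_pos hμ _
  have hrα : r ^ α = μ := Real.rpow_inv_rpow hμ.le hα.1.ne'
  have hscale := integral_comp_mul_left_Ioi
    (fun t => Real.exp (-(s / r) * t) * mittagLeffler α (-(t ^ α))) 0 hr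
  rw [mul_zero, hunit _ (by positivity), Real.rpow_sub (by positivity), Real.rpow_one,
    Real.div_rpow hs.le hr.le, hrα, smul_eq_mul] at hscale
  calc _ = ∫ t in Ioi 0, Real.exp (-(s / r) * (r * t)) * mittagLeffler α (-((r * t) ^ α)) := by
        refine setIntegral_congr_fun measurableSet_Ioi fun t ht => ?_
        rw [neg_mul_rpow_eq_neg_rpow hα.1 hμ ht]
        congr 2
        field_simp
    _ = _ := by
        have hsα : 0 < s ^ α := by positivity
        rw [hscale, Real.rpow_sub hs, Real.rpow_one]
        field_simp

theorem integral_exp_neg_mul_tsum_mittagLeffler (hα : α ∈ Ioo (0 : ℝ) 2) {s : ℝ} (hs : 0 < s)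
    {a μ : ℕ → ℝ} (hμ : ∀ k, 0 < μ k) (ha : Summable fun k => |a k|) :
    ∫ t in Ioi 0, Real.exp (-s * t) * ∑' k, a k * mittagLeffler α (-μ k * t ^ α) =
      s ^ (α - 1) * ∑' k, a k * (s ^ α + μ k)⁻¹ := by
  obtain ⟨M, hM⟩ := exists_abs_mittagLeffler_neg_rpow_le hα
  have hM' (k : ℕ) (t : ℝ) (ht : 0 < t) : |mittagLeffler α (-μ k * t ^ α)| ≤ M := by
    rw [neg_mul_rpow_eq_neg_rpow hα.1 (hμ k) ht]
    exact hM _ (mul_pos (Real.rpow_pos_of_pos (hμ k) _) ht)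
  have hcont (k : ℕ) : ContinuousOn (fun t => mittagLeffler α (-μ k * t ^ α)) (Ioi 0) := by
    refine ((continuousOn_mittagLeffler_neg_rpow hα.1).comp (f := fun t => μ k ^ α⁻¹ * t)
      (by fun_prop) fun t ht => mul_pos (Real.rpow_pos_of_pos (hμ k) _) ht).congr fun t ht => ?_
    simp only [Function.comp_apply]
    rw [neg_mul_rpow_eq_neg_rpow hα.1 (hμ k) ht]
  have hsum := hasSum_integral_of_dominated_convergence (μ := volume.restrict (Ioi (0 : ℝ)))
    (F := fun k t => Real.exp (-s * t) * (a k * mittagLeffler α (-μ k * t ^ α)))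
    (f := fun t => Real.exp (-s * t) * ∑' k, a k * mittagLeffler α (-μ k * t ^ α))
    (fun k t => Real.exp (-s * t) * M * |a k|)
    (fun k => ContinuousOn.aestronglyMeasurable
      (ContinuousOn.mul (by fun_prop) (continuousOn_const.mul (hcont k))) measurableSet_Ioi)
    (fun k => ?_) ?_ ?_ ?_
  · rw [← hsum.tsum_eq, ← tsum_mul_left]
    refine tsum_congr fun k => ?_
    simp_rw [mul_left_comm _ (a k)]
    rw [integral_const_mul, integral_exp_neg_mul_mittagLeffler_neg_mul hα hs (hμ k)]
  · filter_upwards [self_mem_ae_restrict measurableSet_Ioi] with t ht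
    rw [norm_mul, norm_mul, Real.norm_of_nonneg (Real.exp_pos _).le, mul_assoc, mul_comm M]
    gcongr
    · exact le_rfl
    · exact hM' k t ht
  · exact .of_forall fun t => ha.mul_left _
  · simp_rw [tsum_mul_left]
    exact ((integrableOn_exp_mul_Ioi (by linarith) 0).mul_const M).mul_const _
  · filter_upwards [self_mem_ae_restrict measurableSet_Ioi] with t ht
    exact ((summable_abs_mul_of_abs_le ha fun k => hM' k t ht).of_abs.hasSum).mul_left _

end LaplaceOfSeries


theorem dirichlet_sums_equal_of_solutions_equal
    (α : ℝ) (hα : α ∈ Set.Ioo (0 : ℝ) 2) (hα1 : α ≠ 1)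
    (β β₁ : ℝ) (hβ : β ∈ Set.Ioo (0 : ℝ) 1) (hβ₁ : β₁ ∈ Set.Ioo (0 : ℝ) 1)
    (lam : ℕ → ℝ) (hmono : StrictMono lam) (hpos : ∀ k, 0 < lam k)
    (htend : Filter.Tendsto lam Filter.atTop Filter.atTop)
    (a : ℕ → ℝ) (hsum : Summable (fun k => |a k|))
    (hobs : ∀ t : ℝ, 0 < t →
      (∑' k, a k * mittagLeffler α (-(lam k) ^ β * t ^ α))
        = ∑' k, a k * mittagLeffler α (-(lam k) ^ β₁ * t ^ α)) :
    ∀ ℓ : ℕ, 1 ≤ ℓ → (∀ m : ℕ, 1 ≤ m → (ℓ : ℝ) * α ≠ (m : ℝ)) →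
      (∑' k, a k * (lam k) ^ (-(β * ℓ))) = ∑' k, a k * (lam k) ^ (-(β₁ * ℓ)) := by
  intro ℓ hℓ _
  obtain ⟨n, rfl⟩ := Nat.exists_eq_add_of_le' hℓ
  have hpow (γ : ℝ) (k : ℕ) :
      lam k ^ (-(γ * ((n + 1 : ℕ) : ℝ))) = (lam k ^ γ)⁻¹ ^ (n + 1) := by
    rw [Real.rpow_neg (hpos k).le, Real.rpow_mul (hpos k).le, Real.rpow_natCast, inv_pow]
  simp_rw [hpow]
  have hle (γ : ℝ) (hγ : 0 < γ) (k : ℕ) : lam 0 ^ γ ≤ lam k ^ γ :=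
    Real.rpow_le_rpow (hpos 0).le (hmono.monotone (Nat.zero_le k)) hγ.le
  refine tsum_mul_inv_pow_eq_of_tsum_mul_inv_add_eq (m := min (lam 0 ^ β) (lam 0 ^ β₁))
    (lt_min (Real.rpow_pos_of_pos (hpos 0) _) (Real.rpow_pos_of_pos (hpos 0) _))
    (fun k => (min_le_left _ _).trans (hle β hβ.1 k))
    (fun k => (min_le_right _ _).trans (hle β₁ hβ₁.1 k)) hsum hsum (fun z hz => ?_) n
  have hs : 0 < z ^ α⁻¹ := Real.rpow_pos_of_pos hz _
  have hInt := setIntegral_congr_fun (μ := volume) (measurableSet_Ioi (a := (0 : ℝ)))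
    fun t ht => congrArg (Real.exp (-(z ^ α⁻¹) * t) * ·) (hobs t ht)
  rw [integral_exp_neg_mul_tsum_mittagLeffler hα hs (fun k => Real.rpow_pos_of_pos (hpos k) β) hsum,
    integral_exp_neg_mul_tsum_mittagLeffler hα hs (fun k => Real.rpow_pos_of_pos (hpos k) β₁) hsum,
    Real.rpow_inv_rpow hz.le hα.1.ne'] at hInt
  exact mul_left_cancel₀ (Real.rpow_pos_of_pos hs _).ne' hInt
end

section
/- Let α ∈ (0,2) with α ≠ 1, let β ∈ (0,1), let λ : ℕ → ℝ be strictly increasing with λ k > 0 for all k and λ k → ∞, and let a : ℕ → ℝ with Summable (fun k => |a k|). Then the function u : ℝ → ℝ defined by u t = ∑' k, a k * E_{α,1}(-(λ k)^β * t^α) is real-analytic on (0, ∞) (AnalyticOn ℝ u (Set.Ioi 0)). -/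
open Complex MeasureTheory Set Filter Topology

theorem integrableOn_rpow_mul_exp_neg_mul {p b : ℝ} (hp : -1 < p) (hb : 0 < b) :
    IntegrableOn (fun x : ℝ => x ^ p * Real.exp (-(b * x))) (Ioi 0) := by
  simpa using integrableOn_rpow_mul_exp_neg_mul_rpow hp (zero_lt_one' ℝ) hb

/-- The Laplace transform of a power function on the right half-plane. -/
theorem integral_rpow_mul_cexp_neg_mul_Ioi {s : ℝ} (hs : 0 < s) {z : ℂ} (hz : 0 < z.re) :
    ∫ x : ℝ in Ioi 0, ((x ^ (s - 1) : ℝ) : ℂ) * exp (-(z * x)) =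
      exp (-s * log z) * Gamma s := by
  have hopen : IsOpen {w : ℂ | 0 < w.re} := isOpen_lt continuous_const continuous_re
  have hmeas (p : ℝ) (w : ℂ) : AEStronglyMeasurable
      (fun x : ℝ => ((x ^ p : ℝ) : ℂ) * exp (-(w * x))) (volume.restrict (Ioi 0)) := by
    apply Measurable.aestronglyMeasurable
    fun_prop
  have hnorm (p : ℝ) (w : ℂ) (x : ℝ) (hx : 0 < x) :
      ‖((x ^ p : ℝ) : ℂ) * exp (-(w * x))‖ = x ^ p * Real.exp (-(w.re * x)) := by
    rw [norm_mul, norm_exp, norm_real, Real.norm_of_nonneg (Real.rpow_nonneg hx.le _)]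
    simp
  have hL : AnalyticOnNhd ℂ
      (fun w : ℂ => ∫ x : ℝ in Ioi 0, ((x ^ (s - 1) : ℝ) : ℂ) * exp (-(w * x)))
      {w : ℂ | 0 < w.re} := by
    apply DifferentiableOn.analyticOnNhd _ hopen
    intro w hw
    have hw : 0 < w.re := hw
    refine DifferentiableAt.differentiableWithinAt (HasDerivAt.differentiableAt
      (hasDerivAt_integral_of_dominated_loc_of_deriv_le (𝕜 := ℂ)
      (s := {v : ℂ | w.re / 2 < v.re})
      (F' := fun v (x : ℝ) => -(((x ^ s : ℝ) : ℂ) * exp (-(v * x))))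
      (bound := fun x => x ^ s * Real.exp (-(w.re / 2 * x))) ?_ ?_ ?_ ?_ ?_ ?_ ?_).2)
    · exact (isOpen_lt continuous_const continuous_re).mem_nhds (half_lt_self hw)
    · exact .of_forall fun v => hmeas _ v
    · refine (integrableOn_rpow_mul_exp_neg_mul (p := s - 1) (by linarith) hw).mono'
        (hmeas _ w) ?_
      filter_upwards [ae_restrict_mem measurableSet_Ioi] with x hx
      exact (hnorm _ _ _ hx).le
    · exact (hmeas _ w).neg
    · filter_upwards [ae_restrict_mem measurableSet_Ioi] with x hx v hv
      have hx : 0 < x := hx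
      have hv : w.re / 2 < v.re := hv
      rw [norm_neg, hnorm _ _ _ hx]
      gcongr
    · exact integrableOn_rpow_mul_exp_neg_mul (by linarith) (half_pos hw)
    · filter_upwards [ae_restrict_mem measurableSet_Ioi] with x hx v hv
      have hx : 0 < x := hx
      have h := (((hasDerivAt_id v).mul_const (x : ℂ)).neg.cexp).const_mul
        ((x ^ (s - 1) : ℝ) : ℂ)
      refine h.congr_deriv ?_
      have : x ^ s = x ^ (s - 1) * x := by
        rw [Real.rpow_sub_one hx.ne']; field_simp
      rw [this]; push_cast; simp; ring
  have hR : AnalyticOnNhd ℂ (fun w : ℂ => exp (-s * log w) * Gamma s)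
      {w : ℂ | 0 < w.re} := by
    apply DifferentiableOn.analyticOnNhd _ hopen
    intro w hw
    exact (((differentiableAt_log (Or.inl hw)).const_mul _).cexp.mul_const
      _).differentiableWithinAt
  refine hL.eqOn_of_preconnected_of_frequently_eq hR
    (convex_halfSpace_re_gt 0).isPreconnected (z₀ := 1) (by simp) ?_ hz
  have htend : Tendsto (fun r : ℝ => (r : ℂ)) (𝓝[≠] 1) (𝓝[≠] 1) := by
    refine tendsto_nhdsWithin_iff.2 ⟨?_, ?_⟩
    · exact (continuous_ofReal.tendsto' 1 1 (by simp)).mono_left nhdsWithin_le_nhds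
    · filter_upwards [self_mem_nhdsWithin] with r hr
      simpa using hr
  refine htend.frequently (Eventually.frequently ?_)
  filter_upwards [mem_nhdsWithin_of_mem_nhds (Ioi_mem_nhds (zero_lt_one' ℝ))] with r hr
  have hr : 0 < r := hr
  have key := integral_cpow_mul_exp_neg_mul_Ioi (a := s) (by simpa using hs) hr
  have h2 : (1 / (r : ℂ)) ^ (s : ℂ) = exp (-s * log r) := by
    rw [one_div, cpow_def_of_ne_zero (by simp [hr.ne']), log_inv]
    · ring_nf
    · rw [arg_ofReal_of_nonneg hr.le]; exact Real.pi_pos.ne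
  rw [← h2, ← key]
  refine setIntegral_congr_fun measurableSet_Ioi fun x hx => ?_
  have hx : 0 < x := hx
  simp only [ofReal_cpow hx.le, ofReal_sub, ofReal_one]

/-- The vertical line `Re u = 1`, parametrised by `u = 1 + 2πiξ`. -/
noncomputable def vline (ξ : ℝ) : ℂ := 1 + 2 * Real.pi * ξ * I

theorem vline_re (ξ : ℝ) : (vline ξ).re = 1 := by simp [vline]

theorem vline_im (ξ : ℝ) : (vline ξ).im = 2 * Real.pi * ξ := by simp [vline]

theorem one_le_norm_vline (ξ : ℝ) : 1 ≤ ‖vline ξ‖ := by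
  simpa [vline_re] using abs_re_le_norm (vline ξ)

theorem continuous_log_vline : Continuous fun ξ => log (vline ξ) := by
  have : Continuous vline := by unfold vline; fun_prop
  exact this.clog fun ξ => Or.inl (by simp [vline_re])

theorem norm_exp_neg_mul_log_vline (s ξ : ℝ) :
    ‖exp (-s * log (vline ξ))‖ = ‖vline ξ‖ ^ (-s) := by
  rw [norm_exp, Real.rpow_def_of_pos (zero_lt_one.trans_le (one_le_norm_vline ξ)), ← log_re]
  simp [mul_comm]

theorem integrable_norm_vline : Integrable fun ξ : ℝ => ‖vline ξ‖ ^ (-2 : ℝ) := by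
  have h := integrable_inv_one_add_sq.comp_mul_left' (R := 2 * Real.pi) (by positivity)
  refine h.congr (.of_forall fun ξ => ?_)
  simp only
  rw [Real.rpow_neg (norm_nonneg _), Real.rpow_two, ← normSq_eq_norm_sq, normSq_apply, vline_re,
    vline_im]
  ring_nf

theorem integrable_exp_neg_mul_log_vline {s : ℝ} (hs : 2 ≤ s) :
    Integrable fun ξ : ℝ => exp (-s * log (vline ξ)) := by
  refine integrable_norm_vline.mono'
    (continuous_log_vline.const_mul _).cexp.aestronglyMeasurable (.of_forall fun ξ => ?_)
  rw [norm_exp_neg_mul_log_vline]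
  exact Real.rpow_le_rpow_of_exponent_le (one_le_norm_vline ξ) (by linarith)

/-- Laplace's formula for the reciprocal of the Gamma function. -/
theorem integral_exp_mul_vline {s : ℝ} (hs : 2 ≤ s) :
    ∫ ξ : ℝ, exp (vline ξ) * exp (-s * log (vline ξ)) = 1 / Gamma s := by
  let f : ℝ → ℂ := fun x => ((max x 0 ^ (s - 1) * Real.exp (-x) : ℝ) : ℂ)
  have hΓ : Gamma s ≠ 0 := Gamma_ne_zero_of_re_pos (by simp; linarith)
  have hf0 : ∀ x ∉ Ioi (0:ℝ), f x = 0 := by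
    intro x hx
    simp only [f]
    rw [max_eq_right (not_lt.1 hx), Real.zero_rpow (by linarith)]
    simp
  have hfc : Continuous f := by
    refine continuous_ofReal.comp (Continuous.mul ?_ (by fun_prop))
    exact (continuous_id.max continuous_const).rpow_const fun x => Or.inr (by linarith)
  have hfi : Integrable f := by
    rw [← integrableOn_iff_integrable_of_support_subset (s := Ioi 0)
      (fun x hx => by_contra fun h => hx (hf0 x h))]
    refine IntegrableOn.congr_fun (integrableOn_rpow_mul_exp_neg_mul (p := s - 1) (b := 1)
      (by linarith) one_pos).ofReal (fun x hx => ?_) measurableSet_Ioi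
    have hx : 0 < x := hx
    simp [f, max_eq_left hx.le]
  have hF : FourierTransform.fourier f = fun ξ => exp (-s * log (vline ξ)) * Gamma s := by
    funext ξ
    rw [Real.fourier_real_eq_integral_exp_smul, ← integral_rpow_mul_cexp_neg_mul_Ioi
      (by linarith : 0 < s) (by simp [vline_re]), ← setIntegral_eq_integral_of_forall_compl_eq_zero
      (s := Ioi 0) (fun x hx => by rw [hf0 x hx, smul_zero])]
    refine setIntegral_congr_fun measurableSet_Ioi fun x hx => ?_
    have hx : 0 < x := hx
    simp only [f, max_eq_left hx.le, smul_eq_mul, vline]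
    push_cast
    rw [mul_left_comm, ← exp_add]
    ring_nf
  have hinv := hfi.fourierInv_fourier_eq
    (by rw [hF]; exact (integrable_exp_neg_mul_log_vline hs).mul_const _) (v := 1)
    hfc.continuousAt
  rw [hF, Real.fourierInv_eq'] at hinv
  have h1 : f 1 = exp (-1) := by simp [f]
  rw [h1] at hinv
  rw [eq_div_iff hΓ, ← integral_mul_const]
  calc _ = ∫ ξ : ℝ, exp 1 * (exp (↑(2 * Real.pi * inner ℝ ξ 1) * I) •
      (exp (-s * log (vline ξ)) * Gamma s)) := by
        congr 1; funext ξ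
        simp [vline, exp_add, mul_assoc]
    _ = 1 := by rw [integral_const_mul, hinv, ← exp_add]; simp

/-- The Mittag-Leffler series at a complex argument. -/
noncomputable def cmittagLeffler (α : ℝ) (z : ℂ) : ℂ :=
  ∑' n : ℕ, z ^ n / Gamma (α * n + 1)

theorem ofReal_mittagLeffler (α z : ℝ) :
    (mittagLeffler α z : ℂ) = cmittagLeffler α z := by
  simp only [mittagLeffler, cmittagLeffler, ofReal_tsum]
  congr 1; funext n
  push_cast [← Gamma_ofReal]
  rfl

theorem rpow_mul_exp_neg_le_Gamma {s R : ℝ} (hs : 1 ≤ s) (hR : 0 < R) :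
    R ^ (s - 1) * Real.exp (-R) ≤ Real.Gamma s := by
  have hint := Real.GammaIntegral_convergent (zero_lt_one.trans_le hs)
  have hsub : Ioi R ⊆ Ioi 0 := Ioi_subset_Ioi hR.le
  rw [Real.Gamma_eq_integral (zero_lt_one.trans_le hs), ← integral_exp_neg_Ioi,
    ← integral_const_mul]
  calc _ ≤ ∫ x in Ioi R, Real.exp (-x) * x ^ (s - 1) := by
        refine setIntegral_mono_on ((integrableOn_exp_neg_Ioi R).const_mul _)
          (hint.mono_set hsub) measurableSet_Ioi fun x hx => ?_
        have hx : R < x := hx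
        rw [mul_comm]
        gcongr
    _ ≤ _ := by
        refine setIntegral_mono_set hint ?_ hsub.eventuallyLE
        filter_upwards [ae_restrict_mem measurableSet_Ioi] with x hx
        have hx : 0 < x := hx
        positivity

theorem summable_pow_div_Gamma {α R : ℝ} (hα : 0 < α) (hR : 0 < R) :
    Summable fun n : ℕ => R ^ n / Real.Gamma (α * n + 1) := by
  have hg : Summable fun n : ℕ => Real.exp ((2 * R) ^ α⁻¹) * (1 / 2 : ℝ) ^ n :=
    summable_geometric_two.mul_left _
  have hΓ (n : ℕ) : 0 < Real.Gamma (α * n + 1) := Real.Gamma_pos_of_pos (by positivity)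
  refine Summable.of_nonneg_of_le (fun n => div_nonneg (by positivity) (hΓ n).le)
    (fun n => ?_) hg
  have h := rpow_mul_exp_neg_le_Gamma (s := α * n + 1) (R := (2 * R) ^ α⁻¹)
    (by nlinarith [(n.cast_nonneg : (0 : ℝ) ≤ n)]) (by positivity)
  rw [add_sub_cancel_right, ← Real.rpow_mul (by positivity), inv_mul_cancel_left₀ hα.ne',
    Real.rpow_natCast] at h
  rw [div_le_iff₀ (hΓ n)]
  calc R ^ n = Real.exp ((2 * R) ^ α⁻¹) * (1 / 2 : ℝ) ^ n *
      ((2 * R) ^ n * Real.exp (-(2 * R) ^ α⁻¹)) := by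
        rw [Real.exp_neg, mul_pow, one_div, inv_pow]
        field_simp
    _ ≤ _ := by gcongr

theorem differentiable_cmittagLeffler {α : ℝ} (hα : 0 < α) :
    Differentiable ℂ (cmittagLeffler α) := by
  intro z
  have hz : z ∈ Metric.ball (0 : ℂ) (‖z‖ + 1) := by simp
  refine DifferentiableOn.differentiableAt ?_ (Metric.isOpen_ball.mem_nhds hz)
  refine differentiableOn_tsum_of_summable_norm
    (summable_pow_div_Gamma hα (by positivity : 0 < ‖z‖ + 1))
    (fun n => by fun_prop) Metric.isOpen_ball fun n w hw => ?_
  have h : Gamma (α * n + 1) = (Real.Gamma (α * n + 1) : ℂ) := by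
    rw [← Gamma_ofReal]; push_cast; rfl
  have hΓ : 0 < Real.Gamma (α * n + 1) := Real.Gamma_pos_of_pos (by positivity)
  rw [norm_div, norm_pow, h, norm_real, Real.norm_of_nonneg hΓ.le]
  have : ‖w‖ ≤ ‖z‖ + 1 := by simpa using (mem_ball_zero_iff.1 hw).le
  gcongr

theorem sin_le_norm_one_add_exp {γ : ℝ} (hγπ : γ ≤ Real.pi) {y : ℂ}
    (hy : |y.im| ≤ γ) : Real.sin γ ≤ ‖1 + exp y‖ := by
  have hcos : Real.cos γ ≤ Real.cos y.im := by
    rw [← Real.cos_abs y.im]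
    exact Real.cos_le_cos_of_nonneg_of_le_pi (abs_nonneg _) hγπ hy
  refine le_of_sq_le_sq ?_ (norm_nonneg _)
  rw [← normSq_eq_norm_sq, normSq_apply]
  simp only [add_re, add_im, one_re, one_im, exp_re, exp_im, zero_add]
  have h : (1 + Real.exp y.re * Real.cos y.im) * (1 + Real.exp y.re * Real.cos y.im) +
      Real.exp y.re * Real.sin y.im * (Real.exp y.re * Real.sin y.im) =
      1 + 2 * (Real.exp y.re * Real.cos y.im) + Real.exp y.re ^ 2 := by
    linear_combination Real.exp y.re ^ 2 * Real.sin_sq_add_cos_sq y.im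
  rw [h]
  nlinarith [Real.sin_sq_add_cos_sq γ,
    mul_le_mul_of_nonneg_left hcos (Real.exp_pos y.re).le, sq_nonneg (Real.exp y.re + Real.cos γ)]

/-- The factor `1 / (1 + eˣ u ^ (-α))` evaluated at the point `u = vline ξ`. -/
noncomputable def vfactor (α : ℝ) (x : ℂ) (ξ : ℝ) : ℂ :=
  (1 + exp (x - α * log (vline ξ)))⁻¹

/-- The integrand in the Laplace representation of `E_α(-eˣ)`. -/
noncomputable def vkernel (α : ℝ) (x : ℂ) (ξ : ℝ) : ℂ :=
  exp (vline ξ) * exp (-(2 : ℝ) * log (vline ξ)) *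
    ((1 - α) * vfactor α x ξ + α * vfactor α x ξ ^ 2)

theorem abs_im_sub_log_vline_le {α δ : ℝ} (hα : 0 ≤ α) {x : ℂ} (hx : |x.im| ≤ δ) (ξ : ℝ) :
    |(x - α * log (vline ξ)).im| ≤ δ + α * (Real.pi / 2) := by
  have h : |(vline ξ).arg| ≤ Real.pi / 2 :=
    (abs_arg_lt_pi_div_two_iff.2 (Or.inl (by simp [vline_re]))).le
  calc _ = |x.im - α * (vline ξ).arg| := by simp [log_im]
    _ ≤ |x.im| + |α * (vline ξ).arg| := abs_sub _ _
    _ ≤ _ := by rw [abs_mul, abs_of_nonneg hα]; gcongr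

theorem norm_exp_vline_mul (ξ : ℝ) : ‖exp (vline ξ) * exp (-(2 : ℝ) * log (vline ξ))‖ =
    Real.exp 1 * ‖vline ξ‖ ^ (-2 : ℝ) := by
  rw [norm_mul, norm_exp_neg_mul_log_vline, norm_exp, vline_re]

theorem exists_norm_vfactor_le {α δ : ℝ} (hα : 0 < α) (hδ : 0 < δ)
    (hαδ : δ + α * (Real.pi / 2) < Real.pi) :
    ∃ M : ℝ, ∀ (x : ℂ) (ξ : ℝ), |x.im| ≤ δ →
      1 + exp (x - α * log (vline ξ)) ≠ 0 ∧ ‖vfactor α x ξ‖ ≤ M := by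
  have hsin := Real.sin_pos_of_pos_of_lt_pi (by positivity) hαδ
  refine ⟨(Real.sin (δ + α * (Real.pi / 2)))⁻¹, fun x ξ hx => ?_⟩
  have h := sin_le_norm_one_add_exp hαδ.le (abs_im_sub_log_vline_le hα.le hx ξ)
  refine ⟨norm_pos_iff.1 (hsin.trans_le h), ?_⟩
  rw [vfactor, norm_inv]
  gcongr

theorem measurable_vfactor (α : ℝ) (x : ℂ) : Measurable (vfactor α x) := by
  have h : Measurable fun ξ => log (vline ξ) := continuous_log_vline.measurable
  unfold vfactor
  fun_prop

theorem measurable_exp_vline_mul :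
    Measurable fun ξ => exp (vline ξ) * exp (-(2 : ℝ) * log (vline ξ)) := by
  have h : Measurable fun ξ => log (vline ξ) := continuous_log_vline.measurable
  have h' : Measurable vline := by unfold vline; fun_prop
  fun_prop

theorem measurable_vkernel (α : ℝ) (x : ℂ) : Measurable (vkernel α x) := by
  have h := measurable_vfactor α x
  have h' := measurable_exp_vline_mul
  unfold vkernel
  fun_prop

theorem exists_norm_vkernel_le {α δ : ℝ} (hα : 0 < α) (hδ : 0 < δ)
    (hαδ : δ + α * (Real.pi / 2) < Real.pi) :
    ∃ C : ℝ, ∀ (x : ℂ) (ξ : ℝ), |x.im| ≤ δ → ‖vkernel α x ξ‖ ≤ C * ‖vline ξ‖ ^ (-2 : ℝ) := by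
  obtain ⟨M, hM⟩ := exists_norm_vfactor_le hα hδ hαδ
  refine ⟨Real.exp 1 * (‖(1 - α : ℂ)‖ * M + ‖(α : ℂ)‖ * M ^ 2), fun x ξ hx => ?_⟩
  have hv := (hM x ξ hx).2
  rw [vkernel, norm_mul, norm_exp_vline_mul, mul_right_comm]
  gcongr
  refine (norm_add_le _ _).trans ?_
  rw [norm_mul, norm_mul, norm_pow]
  gcongr

theorem differentiableOn_integral_vkernel {α δ : ℝ} (hα : 0 < α) (hδ : 0 < δ)
    (hαδ : δ + α * (Real.pi / 2) < Real.pi) :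
    DifferentiableOn ℂ (fun x => ∫ ξ, vkernel α x ξ) {x : ℂ | |x.im| < δ} := by
  obtain ⟨M, hM⟩ := exists_norm_vfactor_le hα hδ hαδ
  obtain ⟨C, hC⟩ := exists_norm_vkernel_le hα hδ hαδ
  have hopen : IsOpen {x : ℂ | |x.im| < δ} := isOpen_lt (by fun_prop) continuous_const
  have hvd (x : ℂ) (ξ : ℝ) (hx : |x.im| ≤ δ) : HasDerivAt (fun y => vfactor α y ξ)
      (vfactor α x ξ ^ 2 - vfactor α x ξ) x := by
    have hne := (hM x ξ hx).1
    have h := ((((hasDerivAt_id x).sub_const (α * log (vline ξ))).cexp).const_add 1).inv hne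
    refine h.congr_deriv ?_
    simp only [vfactor, id] at hne ⊢
    field_simp
    ring
  intro x hx
  refine DifferentiableAt.differentiableWithinAt (HasDerivAt.differentiableAt
    (hasDerivAt_integral_of_dominated_loc_of_deriv_le (𝕜 := ℂ)
    (s := {x : ℂ | |x.im| < δ})
    (F' := fun y ξ => exp (vline ξ) * exp (-(2 : ℝ) * log (vline ξ)) *
      (((1 - α) + α * (2 * vfactor α y ξ)) * (vfactor α y ξ ^ 2 - vfactor α y ξ)))
    (bound := fun ξ => Real.exp 1 * ((‖(1 - α : ℂ)‖ + ‖(α : ℂ)‖ * (2 * M)) * (M ^ 2 + M)) *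
      ‖vline ξ‖ ^ (-2 : ℝ))
    (hopen.mem_nhds hx) ?_ ?_ ?_ ?_ ?_ ?_).2)
  · exact .of_forall fun y => (measurable_vkernel α y).aestronglyMeasurable
  · exact (integrable_norm_vline.const_mul C).mono'
      (measurable_vkernel α x).aestronglyMeasurable (.of_forall fun ξ => hC x ξ (le_of_lt hx))
  · have h := measurable_vfactor α x
    have h' := measurable_exp_vline_mul
    apply Measurable.aestronglyMeasurable
    fun_prop
  · refine .of_forall fun ξ y hy => ?_
    have hv := (hM y ξ (le_of_lt hy)).2
    rw [norm_mul, norm_exp_vline_mul, mul_right_comm, norm_mul]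
    have hM0 : 0 ≤ M := (norm_nonneg _).trans hv
    gcongr
    · refine (norm_add_le _ _).trans ?_
      rw [norm_mul, norm_mul, norm_ofNat]
      gcongr
    · refine (norm_sub_le _ _).trans ?_
      rw [norm_pow]
      gcongr
  · exact integrable_norm_vline.const_mul _
  · refine .of_forall fun ξ y hy => ?_
    have h := hvd y ξ (le_of_lt hy)
    refine (((h.const_mul (1 - α : ℂ)).add ((h.pow 2).const_mul (α : ℂ))).const_mul
      (exp (vline ξ) * exp (-(2 : ℝ) * log (vline ξ)))).congr_deriv ?_
    push_cast
    ring

theorem hasSum_affine_mul_geometric (α : ℝ) {q : ℂ} (hq : ‖q‖ < 1) :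
    HasSum (fun n : ℕ => (α * n + 1) * q ^ n)
      ((1 - α) * (1 - q)⁻¹ + α * (1 - q)⁻¹ ^ 2) := by
  have h1 : 1 - q ≠ 0 := by
    intro h
    rw [← sub_eq_zero.1 h] at hq
    simp at hq
  have h := ((hasSum_coe_mul_geometric_of_norm_lt_one hq).mul_left (α : ℂ)).add
    (hasSum_geometric_of_norm_lt_one hq)
  have hval : (1 - α) * (1 - q)⁻¹ + α * (1 - q)⁻¹ ^ 2 = α * (q / (1 - q) ^ 2) + (1 - q)⁻¹ := by
    field_simp
    ring
  rw [hval]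
  exact h.congr_fun fun n => by ring

theorem integral_vkernel_eq_of_re_neg {α : ℝ} (hα : 0 < α) {x : ℂ} (hx : x.re < 0) :
    ∫ ξ, vkernel α x ξ = cmittagLeffler α (-exp x) := by
  let K : ℝ → ℂ := fun ξ => exp (vline ξ) * exp (-(2 : ℝ) * log (vline ξ))
  let q : ℝ → ℂ := fun ξ => -exp (x - α * log (vline ξ))
  have hlog : Measurable fun ξ => log (vline ξ) := continuous_log_vline.measurable
  have hK : Measurable K := measurable_exp_vline_mul
  have hqm : Measurable q := by fun_prop
  have hr : Real.exp x.re < 1 := by simpa using hx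
  have hq (ξ : ℝ) : ‖q ξ‖ ≤ Real.exp x.re := by
    simp only [q, norm_neg, norm_exp]
    have : 0 ≤ α * Real.log ‖vline ξ‖ := mul_nonneg hα.le (Real.log_nonneg (one_le_norm_vline ξ))
    refine Real.exp_le_exp.2 ?_
    simpa [log_re] using this
  have hr' : ‖(Real.exp x.re : ℂ)‖ < 1 := by rwa [norm_real, Real.norm_of_nonneg (by positivity)]
  have hsum : Summable fun n : ℕ => (α * n + 1) * Real.exp x.re ^ n := by
    have := (hasSum_affine_mul_geometric α hr').summable
    exact_mod_cast this
  have hterm (n : ℕ) : ∫ ξ, K ξ * ((α * n + 1) * q ξ ^ n) =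
      (-exp x) ^ n / Gamma (α * n + 1) := by
    have h1 : (α * n + 1 : ℂ) ≠ 0 := by
      have : (0:ℝ) < α * n + 1 := by positivity
      exact_mod_cast this.ne'
    have key := integral_exp_mul_vline (s := α * n + 2) (by simp; positivity)
    have hG : Gamma ((α * n + 2 : ℝ) : ℂ) = (α * n + 1) * Gamma (α * n + 1) := by
      rw [← Gamma_add_one _ h1]; push_cast; ring_nf
    calc _ = ∫ ξ, ((α * n + 1) * (-exp x) ^ n) *
          (exp (vline ξ) * exp (-(α * n + 2 : ℝ) * log (vline ξ))) := by
          congr 1; funext ξ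
          simp only [K, q]
          rw [exp_sub, neg_div', div_eq_mul_inv, mul_pow, ← exp_neg, ← exp_nat_mul _ n]
          have : exp (-((α * n + 2 : ℝ) : ℂ) * log (vline ξ)) =
              exp (-(2 : ℝ) * log (vline ξ)) * exp (n * -(α * log (vline ξ))) := by
            rw [← exp_add]; push_cast; ring_nf
          rw [this]; ring
      _ = _ := by
          rw [integral_const_mul, key, hG]
          field_simp
  have h := hasSum_integral_of_dominated_convergence (μ := volume)
    (F := fun (n : ℕ) ξ => K ξ * ((α * n + 1) * q ξ ^ n)) (f := vkernel α x)
    (fun n ξ => Real.exp 1 * ‖vline ξ‖ ^ (-2 : ℝ) * ((α * n + 1) * Real.exp x.re ^ n))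
    (fun n => by apply Measurable.aestronglyMeasurable; fun_prop)
    (fun n => .of_forall fun ξ => ?_) (.of_forall fun ξ => hsum.mul_left _) ?_
    (.of_forall fun ξ => ?_)
  · simp only [hterm] at h
    exact h.tsum_eq.symm
  · have : ‖(α * n + 1 : ℂ)‖ = α * n + 1 := by
      have h0 : (0:ℝ) ≤ α * n + 1 := by positivity
      have := norm_real (α * n + 1)
      rw [Real.norm_of_nonneg h0] at this
      exact_mod_cast this
    rw [norm_mul, norm_exp_vline_mul, norm_mul, norm_pow, this]
    gcongr
    exact hq ξ
  · simp only [tsum_mul_left]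
    exact (integrable_norm_vline.const_mul _).mul_const _
  · have := (hasSum_affine_mul_geometric α ((hq ξ).trans_lt hr)).mul_left (K ξ)
    simpa [K, q, vkernel, vfactor] using this

theorem exists_norm_cmittagLeffler_le {α δ : ℝ} (hα : 0 < α) (hδ : 0 < δ)
    (hαδ : δ + α * (Real.pi / 2) < Real.pi) :
    ∃ C : ℝ, ∀ x : ℂ, |x.im| < δ → ‖cmittagLeffler α (-exp x)‖ ≤ C := by
  obtain ⟨C, hC⟩ := exists_norm_vkernel_le hα hδ hαδ
  refine ⟨∫ ξ, C * ‖vline ξ‖ ^ (-2 : ℝ), fun x hx => ?_⟩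
  have hopen : IsOpen {x : ℂ | |x.im| < δ} := isOpen_lt (by fun_prop) continuous_const
  have hconv : Convex ℝ {x : ℂ | |x.im| < δ} := by
    simp only [abs_lt, ofPred_and]
    exact (convex_halfSpace_im_gt _).inter (convex_halfSpace_im_lt _)
  have hE : DifferentiableOn ℂ (fun x => cmittagLeffler α (-exp x)) {x : ℂ | |x.im| < δ} :=
    ((differentiable_cmittagLeffler hα).comp (by fun_prop)).differentiableOn
  have heq := (hE.analyticOnNhd hopen).eqOn_of_preconnected_of_eventuallyEq
    ((differentiableOn_integral_vkernel hα hδ hαδ).analyticOnNhd hopen) hconv.isPreconnected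
    (z₀ := -1) (by simpa using hδ) (by
      filter_upwards [(isOpen_lt continuous_re continuous_const).mem_nhds
        (by simp : (-1 : ℂ).re < 0)] with y hy
      exact (integral_vkernel_eq_of_re_neg hα hy).symm)
  have := heq hx
  simp only at this
  rw [this]
  exact norm_integral_le_of_norm_le (integrable_norm_vline.const_mul C)
    (.of_forall fun ξ => hC x ξ (le_of_lt hx))

theorem solution_analytic_on_positive_reals
    (α : ℝ) (hα : α ∈ Set.Ioo (0 : ℝ) 2) (hα1 : α ≠ 1)
    (β : ℝ) (hβ : β ∈ Set.Ioo (0 : ℝ) 1)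
    (lam : ℕ → ℝ) (hmono : StrictMono lam) (hpos : ∀ k, 0 < lam k)
    (htend : Filter.Tendsto lam Filter.atTop Filter.atTop)
    (a : ℕ → ℝ) (hsum : Summable (fun k => |a k|)) :
    AnalyticOn ℝ (fun t : ℝ => ∑' k, a k * mittagLeffler α (-(lam k) ^ β * t ^ α))
      (Set.Ioi 0) := by
  obtain ⟨hα0, hα2⟩ := hα
  have hπ := Real.pi_pos
  set δ : ℝ := (Real.pi - α * (Real.pi / 2)) / 2 with hδ_def
  have hδ : 0 < δ := by rw [hδ_def]; nlinarith
  have hαδ : δ + α * (Real.pi / 2) < Real.pi := by linarith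
  obtain ⟨C, hC⟩ := exists_norm_cmittagLeffler_le hα0 hδ hαδ
  let b : ℕ → ℝ := fun k => β * Real.log (lam k)
  let U : ℂ → ℂ := fun x => ∑' k, (a k : ℂ) * cmittagLeffler α (-exp (b k + x))
  have hopen : IsOpen {x : ℂ | |x.im| < δ} := isOpen_lt (by fun_prop) continuous_const
  have hU : AnalyticOnNhd ℂ U {x : ℂ | |x.im| < δ} := by
    refine DifferentiableOn.analyticOnNhd ?_ hopen
    refine differentiableOn_tsum_of_summable_norm (hsum.mul_right C) (fun k => ?_) hopen
      fun k x hx => ?_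
    · exact (((differentiable_cmittagLeffler hα0).comp
        (by fun_prop : Differentiable ℂ fun x : ℂ => -exp (b k + x))).const_mul _).differentiableOn
    · rw [norm_mul, norm_real, Real.norm_eq_abs]
      gcongr
      exact hC _ (by simpa using hx)
  have hUt (t : ℝ) (ht : t ∈ Ioi (0 : ℝ)) :
      ∑' k, a k * mittagLeffler α (-(lam k) ^ β * t ^ α) = (U (α * Real.log t : ℝ)).re := by
    have ht : 0 < t := ht
    have h (k : ℕ) : -exp (b k + (α * Real.log t : ℝ)) =
        ((-(lam k) ^ β * t ^ α : ℝ) : ℂ) := by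
      rw [Real.rpow_def_of_pos (hpos k), Real.rpow_def_of_pos ht, neg_mul, ← Real.exp_add]
      push_cast [b]
      ring_nf
    simp only [U, h, ← ofReal_mittagLeffler, ← ofReal_mul, ← ofReal_tsum, ofReal_re]
  refine AnalyticOn.congr (fun t ht => AnalyticAt.analyticWithinAt ?_) hUt
  have ht' : 0 < t := ht
  have hlog : AnalyticAt ℝ (fun t : ℝ => α * Real.log t) t :=
    analyticAt_const.mul (analyticAt_log ht')
  have hUr : AnalyticAt ℝ U ((α * Real.log t : ℝ) : ℂ) :=
    (hU _ (by simpa only [mem_ofPred_eq, ofReal_im, abs_zero] using hδ)).restrictScalars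
  exact (reCLM.analyticAt _).comp
    (hUr.comp_of_eq ((ofRealCLM.analyticAt _).comp hlog) rfl)
end
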